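/- Let ℂ² have basis e_{-1}, e_1, P° = Σ_{i,j∈{-1,1}} E_{ij}⊗E_{ji}, R°(u) = I − P°/u, and for an operator R on ℂ²⊗ℂ² let R_{ab} denote R acting on tensor factors a,b of (ℂ²)^{⊗4}. Define R_V(u) = ¼ R°₁₂(−1) R°₃₄(−1) R°₁₄(2u−1) R°₁₃(2u) R°₂₄(2u) R°₂₃(2u+1). Then, as identities of rational functions in u, R_V(u) = ¼ R°₁₂(−1) R°₃₄(−1) R°₁₃(2u−1) R°₁₄(2u) R°₂₃(2u) R°₂₄(2u+1) and R_V(u) = ¼ R°₁₂(−1) R°₃₄(−1) R°₂₃(2u−1) R°₂₄(2u) R°₁₃(2u) R°₁₄(2u+1). -/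

import Mathlib

open Matrix Kronecker Finset

noncomputable section

/-- The index set `I_N` as a subtype of `ℤ` determined by a finite set `S ⊆ ℤ`. -/
abbrev Idx (S : Finset ℤ) : Type := {i : ℤ // i ∈ S}

/-- The matrix unit `E_{ab}` of `End(ℂ^N)` (zero if `a` or `b` is not in the index set). -/
def Emat (S : Finset ℤ) (a b : ℤ) : Matrix (Idx S) (Idx S) ℂ :=
  fun p q => if ((p : ℤ) = a ∧ (q : ℤ) = b) then 1 else 0

/-- The permutation operator `P = Σ_{i,j} E_{ij} ⊗ E_{ji}` on `ℂ^N ⊗ ℂ^N`. -/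
def Pmat (S : Finset ℤ) : Matrix (Idx S × Idx S) (Idx S × Idx S) ℂ :=
  ∑ i ∈ S, ∑ j ∈ S, Emat S i j ⊗ₖ Emat S j i

/-- The operator `Q = Σ_{i,j} θ_{ij} E_{ij} ⊗ E_{-i,-j}` on `ℂ^N ⊗ ℂ^N`. -/
def Qmat (S : Finset ℤ) (θ : ℤ → ℤ → ℂ) : Matrix (Idx S × Idx S) (Idx S × Idx S) ℂ :=
  ∑ i ∈ S, ∑ j ∈ S, θ i j • (Emat S i j ⊗ₖ Emat S (-i) (-j))

/-- The R-matrix `R(u) = I - P/u + Q/(u - κ)` of types B, C, D. -/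
def Rmat (S : Finset ℤ) (θ : ℤ → ℤ → ℂ) (κ u : ℂ) :
    Matrix (Idx S × Idx S) (Idx S × Idx S) ℂ :=
  1 - u⁻¹ • Pmat S + (u - κ)⁻¹ • Qmat S θ

/-- `θ_{ij} = 1` (orthogonal case). -/
def θorth : ℤ → ℤ → ℂ := fun _ _ => 1

/-- `θ_{ij} = sign(i)·sign(j)` (symplectic case). -/
def θsymp : ℤ → ℤ → ℂ := fun i j =>
  (if 0 < i then (1 : ℂ) else -1) * (if 0 < j then (1 : ℂ) else -1)

/-- The two-element index set `{-1, 1}` for `ℂ²`. -/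
def S2 : Finset ℤ := {-1, 1}

abbrev V2 : Type := Idx S2

/-- Negation `i ↦ -i` on the index set `{-1, 1}`. -/
def nneg (p : V2) : V2 :=
  ⟨-(p : ℤ), by
    have h := p.2
    simp only [S2, Finset.mem_insert, Finset.mem_singleton] at h ⊢
    omega⟩

/-- The rational R-matrix `R°(u) = I - P°/u` of type A on `ℂ² ⊗ ℂ²`. -/
def Ro (u : ℂ) : Matrix (V2 × V2) (V2 × V2) ℂ := 1 - u⁻¹ • Pmat S2

/-- `sign(i)` for `i ∈ {-1, 1}`. -/
def ssgn : V2 → ℂ := fun i => if 0 < (i : ℤ) then 1 else -1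

/-- Partial transpose applied to the first tensor factor of `ℂ² ⊗ ℂ²`, for the transpose
`M ↦ Σ_{i,j} s(i) s(j) M_{ij} E_{-j,-i}` of `2 × 2` matrices (take `s ≡ 1` for `t₊` and
`s = sign` for `t₋`). -/
def pt1 (s : V2 → ℂ) (X : Matrix (V2 × V2) (V2 × V2) ℂ) :
    Matrix (V2 × V2) (V2 × V2) ℂ :=
  fun p q => s p.1 * s q.1 * X (nneg q.1, p.2) (nneg p.1, q.2)

/-- The fourfold tensor power `(ℂ²)^{⊗4}` index type. -/
abbrev Q4 : Type := V2 × V2 × V2 × V2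

/-- `R_{12}` on `(ℂ²)^{⊗4}`. -/
def L12 (M : Matrix (V2 × V2) (V2 × V2) ℂ) : Matrix Q4 Q4 ℂ :=
  fun p q => M (p.1, p.2.1) (q.1, q.2.1) *
    (if (p.2.2.1, p.2.2.2) = (q.2.2.1, q.2.2.2) then 1 else 0)

/-- `R_{13}` on `(ℂ²)^{⊗4}`. -/
def L13 (M : Matrix (V2 × V2) (V2 × V2) ℂ) : Matrix Q4 Q4 ℂ :=
  fun p q => M (p.1, p.2.2.1) (q.1, q.2.2.1) *
    (if (p.2.1, p.2.2.2) = (q.2.1, q.2.2.2) then 1 else 0)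

/-- `R_{14}` on `(ℂ²)^{⊗4}`. -/
def L14 (M : Matrix (V2 × V2) (V2 × V2) ℂ) : Matrix Q4 Q4 ℂ :=
  fun p q => M (p.1, p.2.2.2) (q.1, q.2.2.2) *
    (if (p.2.1, p.2.2.1) = (q.2.1, q.2.2.1) then 1 else 0)

/-- `R_{23}` on `(ℂ²)^{⊗4}`. -/
def L23 (M : Matrix (V2 × V2) (V2 × V2) ℂ) : Matrix Q4 Q4 ℂ :=
  fun p q => M (p.2.1, p.2.2.1) (q.2.1, q.2.2.1) *
    (if (p.1, p.2.2.2) = (q.1, q.2.2.2) then 1 else 0)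

/-- `R_{24}` on `(ℂ²)^{⊗4}`. -/
def L24 (M : Matrix (V2 × V2) (V2 × V2) ℂ) : Matrix Q4 Q4 ℂ :=
  fun p q => M (p.2.1, p.2.2.2) (q.2.1, q.2.2.2) *
    (if (p.1, p.2.2.1) = (q.1, q.2.2.1) then 1 else 0)

/-- `R_{34}` on `(ℂ²)^{⊗4}`. -/
def L34 (M : Matrix (V2 × V2) (V2 × V2) ℂ) : Matrix Q4 Q4 ℂ :=
  fun p q => M (p.2.2.1, p.2.2.2) (q.2.2.1, q.2.2.2) *
    (if (p.1, p.2.1) = (q.1, q.2.1) then 1 else 0)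

/-- The fused `so₃` R-matrix
`R_V(u) = ¼ R°₁₂(-1) R°₃₄(-1) R°₁₄(2u-1) R°₁₃(2u) R°₂₄(2u) R°₂₃(2u+1)`. -/
def RV (u : ℂ) : Matrix Q4 Q4 ℂ :=
  (4 : ℂ)⁻¹ • (L12 (Ro (-1)) * L34 (Ro (-1)) * L14 (Ro (2 * u - 1)) * L13 (Ro (2 * u)) *
    L24 (Ro (2 * u)) * L23 (Ro (2 * u + 1)))

/-- The permutation operator exchanges the two tensor factors. -/
theorem Pmat_apply (S : Finset ℤ) (p q : Idx S × Idx S) :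
    Pmat S p q = if p.swap = q then 1 else 0 := by
  obtain ⟨⟨a, ha⟩, ⟨b, hb⟩⟩ := p
  obtain ⟨⟨c, hc⟩, ⟨d, hd⟩⟩ := q
  simp only [Pmat, Matrix.sum_apply, Matrix.kroneckerMap_apply, Emat, Prod.swap_prod_mk,
    Prod.mk.injEq, Subtype.mk.injEq]
  rw [Finset.sum_eq_single_of_mem a ha fun i _ hi => Finset.sum_eq_zero fun j _ => by grind,
    Finset.sum_eq_single_of_mem b hb fun j _ hj => by grind]
  grind

/-- The exchange of tensor positions 1 and 2 on basis indices. -/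
def perm12 : Equiv.Perm Q4 where
  toFun := fun ⟨a, b, c, d⟩ => ⟨b, a, c, d⟩
  invFun := fun ⟨a, b, c, d⟩ => ⟨b, a, c, d⟩
  left_inv _ := rfl
  right_inv _ := rfl

theorem L12_Ro (v : ℂ) : L12 (Ro v) = 1 - v⁻¹ • perm12.permMatrix ℂ := by
  ext ⟨a, b, c, d⟩ ⟨a', b', c', d'⟩
  simp only [L12, Ro, perm12, Pmat_apply, Matrix.sub_apply, Matrix.smul_apply,
    Matrix.one_apply, Equiv.Perm.permMatrix, PEquiv.toMatrix_apply, Equiv.toPEquiv_apply,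
    Option.mem_some_iff, Equiv.coe_fn_mk, Prod.swap_prod_mk, Prod.mk.injEq, smul_eq_mul]
  grind

/-- The exchange of tensor positions 1 and 3 on basis indices. -/
def perm13 : Equiv.Perm Q4 where
  toFun := fun ⟨a, b, c, d⟩ => ⟨c, b, a, d⟩
  invFun := fun ⟨a, b, c, d⟩ => ⟨c, b, a, d⟩
  left_inv _ := rfl
  right_inv _ := rfl

theorem L13_Ro (v : ℂ) : L13 (Ro v) = 1 - v⁻¹ • perm13.permMatrix ℂ := by
  ext ⟨a, b, c, d⟩ ⟨a', b', c', d'⟩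
  simp only [L13, Ro, perm13, Pmat_apply, Matrix.sub_apply, Matrix.smul_apply,
    Matrix.one_apply, Equiv.Perm.permMatrix, PEquiv.toMatrix_apply, Equiv.toPEquiv_apply,
    Option.mem_some_iff, Equiv.coe_fn_mk, Prod.swap_prod_mk, Prod.mk.injEq, smul_eq_mul]
  grind

/-- The exchange of tensor positions 1 and 4 on basis indices. -/
def perm14 : Equiv.Perm Q4 where
  toFun := fun ⟨a, b, c, d⟩ => ⟨d, b, c, a⟩
  invFun := fun ⟨a, b, c, d⟩ => ⟨d, b, c, a⟩
  left_inv _ := rfl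
  right_inv _ := rfl

theorem L14_Ro (v : ℂ) : L14 (Ro v) = 1 - v⁻¹ • perm14.permMatrix ℂ := by
  ext ⟨a, b, c, d⟩ ⟨a', b', c', d'⟩
  simp only [L14, Ro, perm14, Pmat_apply, Matrix.sub_apply, Matrix.smul_apply,
    Matrix.one_apply, Equiv.Perm.permMatrix, PEquiv.toMatrix_apply, Equiv.toPEquiv_apply,
    Option.mem_some_iff, Equiv.coe_fn_mk, Prod.swap_prod_mk, Prod.mk.injEq, smul_eq_mul]
  grind

/-- The exchange of tensor positions 2 and 3 on basis indices. -/
def perm23 : Equiv.Perm Q4 where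
  toFun := fun ⟨a, b, c, d⟩ => ⟨a, c, b, d⟩
  invFun := fun ⟨a, b, c, d⟩ => ⟨a, c, b, d⟩
  left_inv _ := rfl
  right_inv _ := rfl

theorem L23_Ro (v : ℂ) : L23 (Ro v) = 1 - v⁻¹ • perm23.permMatrix ℂ := by
  ext ⟨a, b, c, d⟩ ⟨a', b', c', d'⟩
  simp only [L23, Ro, perm23, Pmat_apply, Matrix.sub_apply, Matrix.smul_apply,
    Matrix.one_apply, Equiv.Perm.permMatrix, PEquiv.toMatrix_apply, Equiv.toPEquiv_apply,
    Option.mem_some_iff, Equiv.coe_fn_mk, Prod.swap_prod_mk, Prod.mk.injEq, smul_eq_mul]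
  grind

/-- The exchange of tensor positions 2 and 4 on basis indices. -/
def perm24 : Equiv.Perm Q4 where
  toFun := fun ⟨a, b, c, d⟩ => ⟨a, d, c, b⟩
  invFun := fun ⟨a, b, c, d⟩ => ⟨a, d, c, b⟩
  left_inv _ := rfl
  right_inv _ := rfl

theorem L24_Ro (v : ℂ) : L24 (Ro v) = 1 - v⁻¹ • perm24.permMatrix ℂ := by
  ext ⟨a, b, c, d⟩ ⟨a', b', c', d'⟩
  simp only [L24, Ro, perm24, Pmat_apply, Matrix.sub_apply, Matrix.smul_apply,
    Matrix.one_apply, Equiv.Perm.permMatrix, PEquiv.toMatrix_apply, Equiv.toPEquiv_apply,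
    Option.mem_some_iff, Equiv.coe_fn_mk, Prod.swap_prod_mk, Prod.mk.injEq, smul_eq_mul]
  grind

/-- The exchange of tensor positions 3 and 4 on basis indices. -/
def perm34 : Equiv.Perm Q4 where
  toFun := fun ⟨a, b, c, d⟩ => ⟨a, b, d, c⟩
  invFun := fun ⟨a, b, c, d⟩ => ⟨a, b, d, c⟩
  left_inv _ := rfl
  right_inv _ := rfl

theorem L34_Ro (v : ℂ) : L34 (Ro v) = 1 - v⁻¹ • perm34.permMatrix ℂ := by
  ext ⟨a, b, c, d⟩ ⟨a', b', c', d'⟩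
  simp only [L34, Ro, perm34, Pmat_apply, Matrix.sub_apply, Matrix.smul_apply,
    Matrix.one_apply, Equiv.Perm.permMatrix, PEquiv.toMatrix_apply, Equiv.toPEquiv_apply,
    Option.mem_some_iff, Equiv.coe_fn_mk, Prod.swap_prod_mk, Prod.mk.injEq, smul_eq_mul]
  grind

section Fusion

variable {A : Type*} [Ring A] [Algebra ℂ A]

/-- Fusion: when `P`, `X`, `Y` satisfy the relations of the transpositions `(12)`, `(13)`, `(23)`,
the symmetrizer `1 + P` on the left lets the spectral parameters keep their places while `X` and
`Y` are exchanged. -/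
theorem symmetrizer_mul_exchange {P X Y : A} (hP : P * P = 1) (hXY : X * Y = P * X)
    (hYX : Y * X = P * Y) {v : ℂ} (hv : v ≠ 0) (hw : v + 1 ≠ 0) :
    (1 - (-1 : ℂ)⁻¹ • P) * (1 - v⁻¹ • X) * (1 - (v + 1)⁻¹ • Y) =
      (1 - (-1 : ℂ)⁻¹ • P) * (1 - v⁻¹ • Y) * (1 - (v + 1)⁻¹ • X) := by
  have hPP (Z : A) : P * (P * Z) = Z := by rw [← mul_assoc, hP, one_mul]
  simp only [mul_sub, sub_mul, mul_one, one_mul, smul_mul_assoc, mul_smul_comm, mul_assoc, hXY,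
    hYX, hPP]
  match_scalars <;> field_simp <;> ring

/-- The symmetrizer `1 + P` can be moved through a pair of fused factors, reversing them. -/
theorem symmetrizer_mul_reverse {P X Y : A} (hXY : X * Y = P * X) (hYX : Y * X = P * Y)
    (hPX : Y * P = P * X) (hPY : X * P = P * Y) {v : ℂ} (hv : v ≠ 0) (hw : v + 1 ≠ 0) :
    (1 - (-1 : ℂ)⁻¹ • P) * (1 - v⁻¹ • X) * (1 - (v + 1)⁻¹ • Y) =
      (1 - (v + 1)⁻¹ • Y) * (1 - v⁻¹ • X) * (1 - (-1 : ℂ)⁻¹ • P) := by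
  simp only [mul_sub, sub_mul, mul_one, one_mul, smul_mul_assoc, mul_smul_comm, mul_assoc, hXY,
    hYX, hPX, hPY]
  match_scalars <;> field_simp <;> ring

/-- Given two fused pairs, the exchange of factors can be performed in both pairs at once. -/
theorem symmetrizer_mul_exchange_pair {P X Y X' Y' : A} (hP : P * P = 1)
    (hXY : X * Y = P * X) (hYX : Y * X = P * Y) (hPX : Y * P = P * X) (hPY : X * P = P * Y)
    (hXY' : X' * Y' = P * X') (hYX' : Y' * X' = P * Y')
    {v w : ℂ} (hv : v ≠ 0) (hv' : v + 1 ≠ 0) (hw : w ≠ 0) (hw' : w + 1 ≠ 0) :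
    (1 - (-1 : ℂ)⁻¹ • P) * (1 - v⁻¹ • X) * (1 - (v + 1)⁻¹ • Y) *
        (1 - w⁻¹ • X') * (1 - (w + 1)⁻¹ • Y') =
      (1 - (-1 : ℂ)⁻¹ • P) * (1 - v⁻¹ • Y) * (1 - (v + 1)⁻¹ • X) *
        (1 - w⁻¹ • Y') * (1 - (w + 1)⁻¹ • X') := by
  have h := symmetrizer_mul_exchange hP hXY' hYX' hw hw'
  rw [← symmetrizer_mul_exchange hP hXY hYX hv hv',
    symmetrizer_mul_reverse hXY hYX hPX hPY hv hv']
  simp only [mul_assoc] at h ⊢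
  rw [h]

end Fusion

theorem permMatrix_mul_eq {σ τ ρ π : Equiv.Perm Q4} (h : τ * σ = π * ρ) :
    σ.permMatrix ℂ * τ.permMatrix ℂ = ρ.permMatrix ℂ * π.permMatrix ℂ := by
  rw [← Matrix.permMatrix_mul, ← Matrix.permMatrix_mul, h]

theorem permMatrix_mul_self {σ : Equiv.Perm Q4} (h : σ * σ = 1) :
    σ.permMatrix ℂ * σ.permMatrix ℂ = 1 := by
  rw [← Matrix.permMatrix_mul, h, Matrix.permMatrix_one]

theorem commute_one_sub_smul_permMatrix {σ τ : Equiv.Perm Q4} (h : τ * σ = σ * τ) (a b : ℂ) :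
    Commute (1 - a • σ.permMatrix ℂ) (1 - b • τ.permMatrix ℂ) :=
  have hc : Commute (σ.permMatrix ℂ) (τ.permMatrix ℂ) := permMatrix_mul_eq h
  (Commute.one_left _).sub_left
    ((Commute.one_right _).sub_right ((hc.smul_left a).smul_right b))

/-- the alternative fused expressions (RV:2) and (RV:3) for `R_V(u)`:
`R_V(u) = ¼ R°₁₂(-1) R°₃₄(-1) R°₁₃(2u-1) R°₁₄(2u) R°₂₃(2u) R°₂₄(2u+1)` and
`R_V(u) = ¼ R°₁₂(-1) R°₃₄(-1) R°₂₃(2u-1) R°₂₄(2u) R°₁₃(2u) R°₁₄(2u+1)`. -/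
theorem RV_alternative_forms (u : ℂ)
    (h1 : 2 * u - 1 ≠ 0) (h0 : 2 * u ≠ 0) (h2 : 2 * u + 1 ≠ 0) :
    RV u = (4 : ℂ)⁻¹ • (L12 (Ro (-1)) * L34 (Ro (-1)) * L13 (Ro (2 * u - 1)) *
        L14 (Ro (2 * u)) * L23 (Ro (2 * u)) * L24 (Ro (2 * u + 1))) ∧
    RV u = (4 : ℂ)⁻¹ • (L12 (Ro (-1)) * L34 (Ro (-1)) * L23 (Ro (2 * u - 1)) *
        L24 (Ro (2 * u)) * L13 (Ro (2 * u)) * L14 (Ro (2 * u + 1))) := by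
  have hv : 2 * u - 1 + 1 = 2 * u := by ring
  have h0' : 2 * u - 1 + 1 ≠ 0 := by rwa [hv]
  have e₁ := symmetrizer_mul_exchange_pair (P := perm34.permMatrix ℂ) (X := perm14.permMatrix ℂ)
    (Y := perm13.permMatrix ℂ) (X' := perm24.permMatrix ℂ) (Y' := perm23.permMatrix ℂ)
    (permMatrix_mul_self rfl) (permMatrix_mul_eq rfl) (permMatrix_mul_eq rfl)
    (permMatrix_mul_eq rfl) (permMatrix_mul_eq rfl) (permMatrix_mul_eq rfl)
    (permMatrix_mul_eq rfl) h1 h0' h0 h2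
  have e₂ := symmetrizer_mul_exchange_pair (P := perm12.permMatrix ℂ) (X := perm13.permMatrix ℂ)
    (Y := perm23.permMatrix ℂ) (X' := perm14.permMatrix ℂ) (Y' := perm24.permMatrix ℂ)
    (permMatrix_mul_self rfl) (permMatrix_mul_eq rfl) (permMatrix_mul_eq rfl)
    (permMatrix_mul_eq rfl) (permMatrix_mul_eq rfl) (permMatrix_mul_eq rfl)
    (permMatrix_mul_eq rfl) h1 h0' h0 h2
  rw [hv] at e₁ e₂
  simp only [← L12_Ro, ← L13_Ro, ← L14_Ro, ← L23_Ro, ← L24_Ro, ← L34_Ro] at e₁ e₂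
  have c₁ : Commute (L12 (Ro (-1))) (L34 (Ro (-1))) := by
    rw [L12_Ro, L34_Ro]
    exact commute_one_sub_smul_permMatrix (σ := perm12) (τ := perm34) rfl _ _
  have c₂ : Commute (L14 (Ro (2 * u))) (L23 (Ro (2 * u))) := by
    rw [L14_Ro, L23_Ro]
    exact commute_one_sub_smul_permMatrix (σ := perm14) (τ := perm23) rfl _ _
  have c₃ : Commute (L13 (Ro (2 * u))) (L24 (Ro (2 * u))) := by
    rw [L13_Ro, L24_Ro]
    exact commute_one_sub_smul_permMatrix (σ := perm13) (τ := perm24) rfl _ _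
  have form₂ : L12 (Ro (-1)) * L34 (Ro (-1)) * L14 (Ro (2 * u - 1)) * L13 (Ro (2 * u)) *
      L24 (Ro (2 * u)) * L23 (Ro (2 * u + 1)) =
      L12 (Ro (-1)) * L34 (Ro (-1)) * L13 (Ro (2 * u - 1)) *
        L14 (Ro (2 * u)) * L23 (Ro (2 * u)) * L24 (Ro (2 * u + 1)) := by
    simp only [mul_assoc] at e₁ ⊢
    rw [e₁]
  have form₃ : L12 (Ro (-1)) * L34 (Ro (-1)) * L13 (Ro (2 * u - 1)) *
        L14 (Ro (2 * u)) * L23 (Ro (2 * u)) * L24 (Ro (2 * u + 1)) =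
      L12 (Ro (-1)) * L34 (Ro (-1)) * L23 (Ro (2 * u - 1)) *
        L24 (Ro (2 * u)) * L13 (Ro (2 * u)) * L14 (Ro (2 * u + 1)) := by
    simp only [mul_assoc] at e₂ ⊢
    rw [c₁.left_comm, c₂.left_comm, e₂, c₁.left_comm, c₃.left_comm]
  exact ⟨by rw [RV, form₂], by rw [RV, form₂, form₃]⟩
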